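/- arXiv:2103.13066 — 3 statements merged into one kernel-verified Lean document; each statement's English description precedes it below -/
import Mathlib

section
/- There exists a constant c > 0 such that for every finite nonempty set A ⊂ ℝ, s₊(A)³ · E₊(A) ≥ c·|A|⁴; equivalently, s₊(A) ≥ c'·|A|^{4/3}/E₊(A)^{1/3} for some absolute constant c' > 0. -/
open Finset

/-- A finite set `S ⊂ ℝ` is an additive Sidon set if the only solutions to
`a + b = c + d` with `a,b,c,d ∈ S` are the trivial ones with `{a,b} = {c,d}`. -/
def IsAddSidon (S : Finset ℝ) : Prop :=
  ∀ a ∈ S, ∀ b ∈ S, ∀ c ∈ S, ∀ d ∈ S, a + b = c + d → ({a, b} : Finset ℝ) = {c, d}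

open scoped Classical in
/-- `sAdd A` is the size of the largest additive Sidon subset of `A`. -/
noncomputable def sAdd (A : Finset ℝ) : ℕ :=
  (A.powerset.filter fun S => IsAddSidon S).sup Finset.card

open scoped Classical in
/-- `EAdd A` is the number of ordered quadruples `(a,b,c,d) ∈ A⁴` with `a + b = c + d`. -/
noncomputable def EAdd (A : Finset ℝ) : ℕ :=
  ((A ×ˢ A ×ˢ A ×ˢ A).filter fun x => x.1 + x.2.1 = x.2.2.1 + x.2.2.2).card

/-- Averaging over random subsets: if every element of `A` is kept with probability `p`, then some
outcome is at least as large as the expected total weight of the sets `e i` that survive. -/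
theorem exists_subset_sum_mul_pow_card_le {α ι : Type*} [DecidableEq α] {p : ℝ} (hp₀ : 0 ≤ p)
    (hp₁ : p ≤ 1) (A : Finset α) (w : ι → ℝ) :
    ∀ (I : Finset ι) (e : ι → Finset α), (∀ i ∈ I, e i ⊆ A) →
      ∃ S ⊆ A, ∑ i ∈ I, w i * p ^ #(e i) ≤ ∑ i ∈ I with e i ⊆ S, w i := by
  induction A using Finset.induction_on with
  | empty =>
    intro I e he
    refine ⟨∅, subset_rfl, ?_⟩
    rw [Finset.filter_true_of_mem he]
    refine Finset.sum_le_sum fun i hi => ?_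
    simp [Finset.subset_empty.1 (he i hi)]
  | insert a A ha ih =>
    intro I e he
    obtain ⟨S₁, hS₁, h₁⟩ := ih I (fun i => (e i).erase a)
      fun i hi => Finset.subset_insert_iff.1 (he i hi)
    obtain ⟨S₀, hS₀, h₀⟩ := ih (I.filter fun i => a ∉ e i) e fun i hi =>
      (Finset.subset_insert_iff_of_notMem (Finset.mem_filter.1 hi).2).1
        (he i (Finset.mem_filter.1 hi).1)
    have hsplit : ∑ i ∈ I, w i * p ^ #(e i) =
        p * ∑ i ∈ I, w i * p ^ #((e i).erase a) +
          (1 - p) * ∑ i ∈ I with a ∉ e i, w i * p ^ #(e i) := by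
      rw [Finset.sum_filter, Finset.mul_sum, Finset.mul_sum, ← Finset.sum_add_distrib]
      refine Finset.sum_congr rfl fun i _ => ?_
      by_cases hi : a ∈ e i
      · rw [← Finset.card_erase_add_one hi, pow_succ]
        simp [hi]
        ring
      · simp [hi]
        ring
    have h₁' : ∑ i ∈ I with (e i).erase a ⊆ S₁, w i = ∑ i ∈ I with e i ⊆ insert a S₁, w i := by
      simp_rw [Finset.subset_insert_iff]
    have h₀' : ∑ i ∈ I.filter (fun i => a ∉ e i) with e i ⊆ S₀, w i =
        ∑ i ∈ I with e i ⊆ S₀, w i := by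
      rw [Finset.filter_filter]
      congr 1
      refine Finset.filter_congr fun i _ => ?_
      exact ⟨fun h => h.2, fun h => ⟨fun hi => ha (hS₀ (h hi)), h⟩⟩
    rw [h₁'] at h₁
    rw [h₀'] at h₀
    by_contra! hcon
    have c₁ := hcon (insert a S₁) (Finset.insert_subset_insert a hS₁)
    have c₀ := hcon S₀ (hS₀.trans (Finset.subset_insert a A))
    have hlt := max_lt (h₁.trans_lt c₁) (h₀.trans_lt c₀)
    have hp := add_le_add
      (mul_le_mul_of_nonneg_left (le_max_left (∑ i ∈ I, w i * p ^ #((e i).erase a))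
        (∑ i ∈ I with a ∉ e i, w i * p ^ #(e i))) hp₀)
      (mul_le_mul_of_nonneg_left (le_max_right (∑ i ∈ I, w i * p ^ #((e i).erase a))
        (∑ i ∈ I with a ∉ e i, w i * p ^ #(e i))) (sub_nonneg.2 hp₁))
    rw [← hsplit, ← add_mul] at hp
    linarith

/-- Deletion method: a hypergraph with edges `e j` on the vertex set `A` has an independent set of
size at least `p |A| - ∑ p ^ |e j|`. -/
theorem exists_independent_subset_card_ge {α κ : Type*} [DecidableEq α] {p : ℝ} (hp₀ : 0 ≤ p)
    (hp₁ : p ≤ 1) (A : Finset α) (J : Finset κ) (e : κ → Finset α) (he : ∀ j ∈ J, e j ⊆ A)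
    (hne : ∀ j ∈ J, (e j).Nonempty) :
    ∃ S ⊆ A, (∀ j ∈ J, ¬ e j ⊆ S) ∧ p * #A - ∑ j ∈ J, p ^ #(e j) ≤ #S := by
  classical
  obtain ⟨S, hSA, hS⟩ := exists_subset_sum_mul_pow_card_le hp₀ hp₁ A
    (Sum.elim (fun _ : α => (1 : ℝ)) fun _ : κ => -1) (A.disjSum J)
    (Sum.elim (fun a => {a}) e) (by
      intro i hi
      rcases Finset.mem_disjSum.1 hi with ⟨a, ha, rfl⟩ | ⟨j, hj, rfl⟩
      · simpa using ha
      · exact he j hj)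
  obtain rfl | ⟨j₀, hj₀⟩ := J.eq_empty_or_nonempty
  · exact ⟨A, subset_rfl, by simp, by simpa using mul_le_of_le_one_left (Nat.cast_nonneg _) hp₁⟩
  have : Nonempty α := ⟨(hne j₀ hj₀).choose⟩
  choose! v hv using hne
  rw [Finset.sum_filter, Finset.sum_disjSum, Finset.sum_disjSum] at hS
  simp only [Sum.elim_inl, Sum.elim_inr, ← Finset.sum_filter, Finset.card_singleton, pow_one,
    one_mul, neg_mul, Finset.sum_neg_distrib, Finset.sum_const, nsmul_eq_mul, mul_one,
    Finset.singleton_subset_iff] at hS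
  rw [Finset.filter_mem_eq_inter, Finset.inter_eq_right.2 hSA] at hS
  have hbad : ∑ j ∈ J, (if e j ⊆ S then (-1 : ℝ) else 0) = -#(J.filter fun j => e j ⊆ S) := by
    rw [← Finset.sum_filter]
    simp
  have hS' : (#A : ℝ) * p + -∑ j ∈ J, p ^ #(e j) ≤ #S + -#(J.filter fun j => e j ⊆ S) := by
    rw [← hbad]
    exact hS
  refine ⟨S \ (J.filter fun j => e j ⊆ S).image v, Finset.sdiff_subset.trans hSA, ?_, ?_⟩
  · intro j hj hsub
    refine (Finset.mem_sdiff.1 (hsub (hv j hj))).2 (Finset.mem_image_of_mem v ?_)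
    exact Finset.mem_filter.2 ⟨hj, hsub.trans Finset.sdiff_subset⟩
  · have h₁ := Finset.le_card_sdiff ((J.filter fun j => e j ⊆ S).image v) S
    have h₂ : #((J.filter fun j => e j ⊆ S).image v) ≤ #(J.filter fun j => e j ⊆ S) :=
      Finset.card_image_le
    have h₃ : #S ≤ #(S \ (J.filter fun j => e j ⊆ S).image v) + #(J.filter fun j => e j ⊆ S) := by
      omega
    have h₄ : (#S : ℝ) ≤ #(S \ (J.filter fun j => e j ⊆ S).image v) +
        #(J.filter fun j => e j ⊆ S) := by
      exact_mod_cast h₃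
    linarith

theorem card_le_sAdd {A S : Finset ℝ} (hSA : S ⊆ A) (hS : IsAddSidon S) : #S ≤ sAdd A := by
  classical
  exact Finset.le_sup (f := Finset.card) (Finset.mem_filter.2 ⟨Finset.mem_powerset.2 hSA, hS⟩)

theorem card_le_EAdd (A : Finset ℝ) : #A ≤ EAdd A := by
  refine Finset.card_le_card_of_injOn (fun a => (a, a, a, a)) ?_ ?_
  · intro a ha
    have ha' : a ∈ A := ha
    simp [ha']
  · intro a _ b _ h
    exact (Prod.mk.inj h).1

/-- The triples `(a, c, d)` in `A` with `2a = c + d`, grouped as a midpoint and a pair. -/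
noncomputable def midpointTriples (A : Finset ℝ) : Finset (ℝ × ℝ × ℝ) :=
  (A ×ˢ A ×ˢ A).filter fun x => x.1 + x.1 = x.2.1 + x.2.2

/-- Cauchy–Schwarz bound for the number of three-term progressions by the additive energy. -/
theorem card_midpointTriples_sq_le (A : Finset ℝ) :
    #(midpointTriples A) ^ 2 ≤ #A * EAdd A := by
  classical
  have hfib : #(midpointTriples A) =
      ∑ a ∈ A, #((A ×ˢ A).filter fun y => a + a = y.1 + y.2) := by
    rw [midpointTriples, Finset.card_filter, Finset.sum_product]
    simp_rw [Finset.card_filter]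
  have hsq : ∑ a ∈ A, #((A ×ˢ A).filter fun y => a + a = y.1 + y.2) ^ 2 ≤ EAdd A := by
    have hsig : ∑ a ∈ A, #((A ×ˢ A).filter fun y => a + a = y.1 + y.2) ^ 2 =
        #(A.sigma fun a => ((A ×ˢ A).filter fun y => a + a = y.1 + y.2) ×ˢ
          ((A ×ˢ A).filter fun y => a + a = y.1 + y.2)) := by
      rw [Finset.card_sigma]
      exact Finset.sum_congr rfl fun a _ => by rw [Finset.card_product, sq]
    rw [hsig]
    refine Finset.card_le_card_of_injOn
      (fun x => (x.2.1.1, x.2.1.2, x.2.2.1, x.2.2.2)) ?_ ?_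
    · rintro ⟨a, ⟨b, c⟩, ⟨b', c'⟩⟩ h
      simp only [Finset.coe_sigma, Set.mem_sigma_iff, Finset.mem_coe, Finset.mem_product,
        Finset.mem_filter] at h ⊢
      obtain ⟨-, ⟨⟨hb, hc⟩, h₁⟩, ⟨hb', hc'⟩, h₂⟩ := h
      exact ⟨⟨hb, hc, hb', hc'⟩, by linarith⟩
    · rintro ⟨a, ⟨b, c⟩, ⟨b', c'⟩⟩ h ⟨d, ⟨x, y⟩, ⟨x', y'⟩⟩ h' heq
      simp only [Finset.coe_sigma, Set.mem_sigma_iff, Finset.mem_coe, Finset.mem_product,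
        Finset.mem_filter] at h h'
      simp only [Prod.mk.injEq] at heq
      obtain ⟨rfl, rfl, rfl, rfl⟩ := heq
      obtain rfl : a = d := by linarith [h.2.1.2, h'.2.1.2]
      rfl
  rw [hfib]
  exact sq_sum_le_card_mul_sum_sq.trans (Nat.mul_le_mul_left _ hsq)

/-- Avoiding all solutions in four distinct elements and all proper three-term progressions
suffices for being Sidon. -/
theorem isAddSidon_of_forall_ne {S : Finset ℝ}
    (h₄ : ∀ a ∈ S, ∀ b ∈ S, ∀ c ∈ S, ∀ d ∈ S, a + b = c + d → #({a, b, c, d} : Finset ℝ) ≠ 4)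
    (h₃ : ∀ a ∈ S, ∀ c ∈ S, ∀ d ∈ S, a + a = c + d → c = d) : IsAddSidon S := by
  intro a ha b hb c hc d hd h
  by_cases hac : a = c
  · obtain rfl : b = d := by linarith
    rw [hac]
  by_cases had : a = d
  · obtain rfl : b = c := by linarith
    rw [had, Finset.pair_comm]
  have hbc : b ≠ c := fun hbc => had (by linarith)
  have hbd : b ≠ d := fun hbd => hac (by linarith)
  by_cases hab : a = b
  · subst hab
    have := h₃ a ha c hc d hd h
    exact absurd (by linarith) hac
  by_cases hcd : c = d
  · subst hcd
    exact absurd (h₃ c hc a ha b hb h.symm) hab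
  · exact absurd (by simp [hab, hac, had, hbc, hbd, hcd]) (h₄ a ha b hb c hc d hd h)

/-- The deletion bound for Sidon subsets. -/
theorem mul_card_sub_le_sAdd (A : Finset ℝ) {p : ℝ} (hp₀ : 0 ≤ p) (hp₁ : p ≤ 1) :
    p * #A - (EAdd A * p ^ 4 + #(midpointTriples A) * p ^ 3) ≤ sAdd A := by
  classical
  set Q : Finset (ℝ × ℝ × ℝ × ℝ) := (A ×ˢ A ×ˢ A ×ˢ A).filter fun x =>
    x.1 + x.2.1 = x.2.2.1 + x.2.2.2 ∧ #({x.1, x.2.1, x.2.2.1, x.2.2.2} : Finset ℝ) = 4 with hQ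
  set T : Finset (ℝ × ℝ × ℝ) := (midpointTriples A).filter fun x => x.2.1 ≠ x.2.2 with hT
  set eQ : ℝ × ℝ × ℝ × ℝ → Finset ℝ := fun x => {x.1, x.2.1, x.2.2.1, x.2.2.2} with heQ
  set eT : ℝ × ℝ × ℝ → Finset ℝ := fun x => {x.1, x.2.1, x.2.2} with heT
  have hQE : (#Q : ℝ) ≤ EAdd A := by
    refine Nat.cast_le.2 (Finset.card_le_card fun x hx => ?_)
    rw [hQ, Finset.mem_filter] at hx
    exact Finset.mem_filter.2 ⟨hx.1, hx.2.1⟩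
  have hTT : (#T : ℝ) ≤ #(midpointTriples A) :=
    Nat.cast_le.2 (Finset.card_filter_le _ _)
  have hcQ : ∀ x ∈ Q, #(eQ x) = 4 := fun x hx => (Finset.mem_filter.1 hx).2.2
  have hcT : ∀ x ∈ T, #(eT x) = 3 := by
    rintro ⟨a, c, d⟩ hx
    simp only [hT, midpointTriples, Finset.mem_filter] at hx
    obtain ⟨⟨-, h⟩, hcd⟩ := hx
    refine Finset.card_eq_three.2 ⟨a, c, d, ?_, ?_, hcd, rfl⟩
    · intro hac
      exact hcd (by linarith)
    · intro had
      exact hcd (by linarith)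
  obtain ⟨S, hSA, hind, hcard⟩ := exists_independent_subset_card_ge hp₀ hp₁ A (Q.disjSum T)
    (Sum.elim eQ eT)
    (by
      intro j hj
      rcases Finset.mem_disjSum.1 hj with ⟨x, hx, rfl⟩ | ⟨x, hx, rfl⟩
      · simp only [hQ, Finset.mem_filter, Finset.mem_product] at hx
        simp [heQ, Finset.insert_subset_iff, hx]
      · simp only [hT, midpointTriples, Finset.mem_filter, Finset.mem_product] at hx
        simp [heT, Finset.insert_subset_iff, hx])
    (by
      intro j hj
      rcases Finset.mem_disjSum.1 hj with ⟨x, hx, rfl⟩ | ⟨x, hx, rfl⟩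
      · exact Finset.insert_nonempty _ _
      · exact Finset.insert_nonempty _ _)
  rw [Finset.sum_disjSum] at hcard
  simp only [Sum.elim_inl, Sum.elim_inr] at hcard
  have hsQ : ∑ x ∈ Q, p ^ #(eQ x) = #Q * p ^ 4 := by
    rw [← nsmul_eq_mul]
    exact Finset.sum_eq_card_nsmul fun x hx => by rw [hcQ x hx]
  have hsT : ∑ x ∈ T, p ^ #(eT x) = #T * p ^ 3 := by
    rw [← nsmul_eq_mul]
    exact Finset.sum_eq_card_nsmul fun x hx => by rw [hcT x hx]
  rw [hsQ, hsT] at hcard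
  have hSidon : IsAddSidon S := by
    refine isAddSidon_of_forall_ne ?_ ?_
    · intro a ha b hb c hc d hd h h4
      refine hind (Sum.inl (a, b, c, d)) (Finset.inl_mem_disjSum.2 ?_) ?_
      · simp only [hQ, Finset.mem_filter, Finset.mem_product]
        exact ⟨⟨hSA ha, hSA hb, hSA hc, hSA hd⟩, h, h4⟩
      · simp [heQ, Finset.insert_subset_iff, ha, hb, hc, hd]
    · intro a ha c hc d hd h
      by_contra hcd
      refine hind (Sum.inr (a, c, d)) (Finset.inr_mem_disjSum.2 ?_) ?_
      · simp only [hT, midpointTriples, Finset.mem_filter, Finset.mem_product]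
        exact ⟨⟨⟨hSA ha, hSA hc, hSA hd⟩, h⟩, hcd⟩
      · simp [heT, Finset.insert_subset_iff, ha, hc, hd]
  have hS : (#S : ℝ) ≤ sAdd A := Nat.cast_le.2 (card_le_sAdd hSA hSidon)
  have h1 : (#Q : ℝ) * p ^ 4 ≤ EAdd A * p ^ 4 := by gcongr
  have h2 : (#T : ℝ) * p ^ 3 ≤ #(midpointTriples A) * p ^ 3 := by gcongr
  linarith

/-- An integer approximation, from above, of the cube root of `8E / n`. -/
theorem exists_two_le_mul_cube {n E : ℕ} (hn : 0 < n) (hE : n ≤ E) :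
    ∃ k : ℕ, 2 ≤ k ∧ 8 * E ≤ n * k ^ 3 ∧ n * k ^ 3 ≤ 64 * E := by
  have hex : ∃ k : ℕ, 8 * E ≤ n * k ^ 3 := by
    refine ⟨8 * E, ?_⟩
    have h : 8 * E ≤ (8 * E) ^ 3 := Nat.le_self_pow (by norm_num) _
    exact h.trans (Nat.le_mul_of_pos_left _ hn)
  classical
  have hk := Nat.find_spec hex
  have hmin := fun m (hm : m < Nat.find hex) => Nat.find_min hex hm
  generalize Nat.find hex = k at hk hmin
  have hk2 : 2 ≤ k := by
    by_contra! hlt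
    interval_cases k <;> omega
  obtain ⟨m, rfl⟩ : ∃ m, k = m + 1 := ⟨k - 1, by omega⟩
  have hm := hmin m (Nat.lt_succ_self m)
  have hcube : (m + 1) ^ 3 ≤ (2 * m) ^ 3 := Nat.pow_le_pow_left (by omega) 3
  refine ⟨m + 1, hk2, hk, ?_⟩
  calc n * (m + 1) ^ 3 ≤ n * (2 * m) ^ 3 := Nat.mul_le_mul_left _ hcube
    _ = 8 * (n * m ^ 3) := by ring
    _ ≤ 64 * E := by omega

theorem card_pow_four_le_mul_sAdd_pow_mul_EAdd {A : Finset ℝ} (hA : A.Nonempty) :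
    (#A : ℝ) ^ 4 ≤ 4096 * ((sAdd A : ℝ) ^ 3 * EAdd A) := by
  obtain ⟨k, hk2, hk8, hk64⟩ := exists_two_le_mul_cube hA.card_pos (card_le_EAdd A)
  have hT := card_midpointTriples_sq_le A
  have hdel := mul_card_sub_le_sAdd A (p := (k : ℝ)⁻¹) (by positivity)
    (inv_le_one_of_one_le₀ (by exact_mod_cast (by omega : 1 ≤ k)))
  have hn : (0 : ℝ) < #A := by exact_mod_cast hA.card_pos
  generalize hnn : (#A : ℝ) = n at *
  generalize hss : (sAdd A : ℝ) = s at *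
  have hT' : (#(midpointTriples A) : ℝ) ^ 2 ≤ n * (EAdd A : ℝ) := by
    rw [← hnn]; exact_mod_cast hT
  have hk8' : 8 * (EAdd A : ℝ) ≤ n * (k : ℝ) ^ 3 := by rw [← hnn]; exact_mod_cast hk8
  have hk64' : n * (k : ℝ) ^ 3 ≤ 64 * (EAdd A : ℝ) := by rw [← hnn]; exact_mod_cast hk64
  have hk2' : (2 : ℝ) ≤ k := by exact_mod_cast hk2
  have hE₀ : (0 : ℝ) ≤ EAdd A := Nat.cast_nonneg _
  have hT₀ : (0 : ℝ) ≤ #(midpointTriples A) := Nat.cast_nonneg _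
  generalize (EAdd A : ℝ) = E at *
  generalize (#(midpointTriples A) : ℝ) = t at *
  generalize (k : ℝ) = x at *
  have hx : 0 < x := by linarith
  have ht : 2 * t ≤ n * x ^ 2 := by
    refine le_of_pow_le_pow_left₀ (n := 2) (by norm_num) (by positivity) ?_
    have : n * x ^ 3 * 2 ≤ n * x ^ 3 * x := by gcongr
    nlinarith
  have hs : n ≤ 4 * (x * s) := by
    have h₁ : x * (x⁻¹ * n - (E * x⁻¹ ^ 4 + t * x⁻¹ ^ 3)) = n - (E / x ^ 3 + t / x ^ 2) := by
      field_simp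
    have h₂ : E / x ^ 3 ≤ n / 8 := by
      rw [div_le_iff₀ (by positivity)]; linarith
    have h₃ : t / x ^ 2 ≤ n / 2 := by
      rw [div_le_iff₀ (by positivity)]; linarith
    have h₄ := mul_le_mul_of_nonneg_left hdel hx.le
    rw [h₁] at h₄
    linarith
  have hs₀ : 0 ≤ s := by rw [← hss]; exact Nat.cast_nonneg _
  calc n ^ 4 = n * n ^ 3 := by ring
    _ ≤ n * (4 * (x * s)) ^ 3 := by gcongr
    _ = 64 * s ^ 3 * (n * x ^ 3) := by ring
    _ ≤ 64 * s ^ 3 * (64 * E) := by gcongr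
    _ = 4096 * (s ^ 3 * E) := by ring

theorem stmt8 :
    ∃ c : ℝ, 0 < c ∧ ∃ c' : ℝ, 0 < c' ∧ ∀ A : Finset ℝ, A.Nonempty →
      c * (A.card : ℝ) ^ 4 ≤ (sAdd A : ℝ) ^ 3 * (EAdd A : ℝ) ∧
      c' * (A.card : ℝ) ^ ((4 : ℝ) / 3) / (EAdd A : ℝ) ^ ((1 : ℝ) / 3) ≤ (sAdd A : ℝ) := by
  refine ⟨1 / 4096, by norm_num, 1 / 16, by norm_num, fun A hA => ?_⟩
  have h := card_pow_four_le_mul_sAdd_pow_mul_EAdd hA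
  refine ⟨by linarith, ?_⟩
  have hE : (0 : ℝ) < EAdd A := by
    exact_mod_cast hA.card_pos.trans_le (card_le_EAdd A)
  have hn : (0 : ℝ) ≤ #A := Nat.cast_nonneg _
  have hs : (0 : ℝ) ≤ sAdd A := Nat.cast_nonneg _
  have hn3 : ((#A : ℝ) ^ ((4 : ℝ) / 3)) ^ 3 = (#A : ℝ) ^ 4 := by
    rw [← Real.rpow_mul_natCast hn, ← Real.rpow_natCast]
    norm_num
  have hE3 : ((EAdd A : ℝ) ^ ((1 : ℝ) / 3)) ^ 3 = EAdd A := by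
    rw [← Real.rpow_mul_natCast hE.le]
    norm_num
  rw [div_le_iff₀ (Real.rpow_pos_of_pos hE _)]
  refine le_of_pow_le_pow_left₀ (n := 3) (by norm_num) (by positivity) ?_
  rw [mul_pow, mul_pow, hn3, hE3]
  linarith
end

section
/- There exists a constant c > 0 such that for every finite nonempty set A of positive real numbers, s₊ˣ(A)³ · Eˣ(A) ≥ c·|A|⁴, where s₊ˣ(A) is the size of the largest multiplicative Sidon subset of A and Eˣ(A) is the multiplicative energy of A. -/
open Finset

/-- A finite set `S ⊂ ℝ` is a multiplicative Sidon set if the only solutions to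
`a * b = c * d` with `a,b,c,d ∈ S` are the trivial ones with `{a,b} = {c,d}`. -/
def IsMulSidon (S : Finset ℝ) : Prop :=
  ∀ a ∈ S, ∀ b ∈ S, ∀ c ∈ S, ∀ d ∈ S, a * b = c * d → ({a, b} : Finset ℝ) = {c, d}

open scoped Classical in
/-- `sMul A` is the size of the largest multiplicative Sidon subset of `A`. -/
noncomputable def sMul (A : Finset ℝ) : ℕ :=
  (A.powerset.filter fun S => IsMulSidon S).sup Finset.card

open scoped Classical in
/-- `EMul A` is the number of ordered quadruples `(a,b,c,d) ∈ A⁴` with `a * b = c * d`. -/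
noncomputable def EMul (A : Finset ℝ) : ℕ :=
  ((A ×ˢ A ×ˢ A ×ˢ A).filter fun x => x.1 * x.2.1 = x.2.2.1 * x.2.2.2).card

/-- If every element of `A` is kept independently with probability `p`, then a given subset `T`
survives with probability `p ^ #T`. -/
theorem sum_Icc_pow_mul_pow {α : Type*} [DecidableEq α] {T A : Finset α} (hT : T ⊆ A) (p : ℝ) :
    ∑ S ∈ Finset.Icc T A, p ^ #S * (1 - p) ^ (#A - #S) = p ^ #T := by
  rw [Finset.Icc_eq_image_powerset hT, Finset.sum_image]
  · have h : ∀ S ∈ (A \ T).powerset,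
        p ^ #(T ∪ S) * (1 - p) ^ (#A - #(T ∪ S)) =
          p ^ #T * (p ^ #S * (1 - p) ^ (#(A \ T) - #S)) := by
      intro S hS
      rw [Finset.mem_powerset] at hS
      have hd : Disjoint T S := (Finset.disjoint_sdiff).mono_right hS
      rw [Finset.card_union_of_disjoint hd, Finset.card_sdiff_of_subset hT, pow_add, Nat.sub_sub,
        mul_assoc]
    rw [Finset.sum_congr rfl h, ← Finset.mul_sum, Finset.sum_pow_mul_eq_add_pow]
    simp
  · intro S hS S' hS' h
    rw [Finset.mem_coe, Finset.mem_powerset] at hS hS'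
    have hd : Disjoint T S := (Finset.disjoint_sdiff).mono_right hS
    have hd' : Disjoint T S' := (Finset.disjoint_sdiff).mono_right hS'
    have h' : T ∪ S = T ∪ S' := h
    rw [← Finset.union_sdiff_cancel_left hd, h', Finset.union_sdiff_cancel_left hd']

/-- The deletion method: a hypergraph on `A` has an independent set of size at least
`p * #A - ∑ e, p ^ #e`. -/
theorem exists_independent_subset {α : Type*} [DecidableEq α] (A : Finset α)
    (H : Finset (Finset α)) (hH : ∀ e ∈ H, e ⊆ A ∧ e.Nonempty) {p : ℝ} (hp0 : 0 ≤ p)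
    (hp1 : p ≤ 1) :
    ∃ S ⊆ A, (∀ e ∈ H, ¬ e ⊆ S) ∧ p * #A - ∑ e ∈ H, p ^ #e ≤ #S := by
  obtain ⟨S, hS, hle⟩ : ∃ S ∈ A.powerset,
      p * #A - ∑ e ∈ H, p ^ #e ≤ (#S : ℝ) - #{e ∈ H | e ⊆ S} := by
    by_contra! hlt
    set w : Finset α → ℝ := fun S => p ^ #S * (1 - p) ^ (#A - #S) with hw
    have hw0 : ∀ S, 0 ≤ w S := fun S => mul_nonneg (pow_nonneg hp0 _)
      (pow_nonneg (sub_nonneg.2 hp1) _)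
    have hIcc : ∀ T ⊆ A, ∑ S ∈ A.powerset, (if T ⊆ S then w S else 0) = p ^ #T := by
      intro T hT
      rw [← sum_Icc_pow_mul_pow hT p, ← Finset.sum_filter]
      refine Finset.sum_congr ?_ fun _ _ => rfl
      ext S
      simp [and_comm]
    have hw1 : ∑ S ∈ A.powerset, w S = 1 := by simpa using hIcc ∅ (Finset.empty_subset _)
    have hcard : ∑ S ∈ A.powerset, w S * #S = p * #A := by
      have h : ∀ S ∈ A.powerset, w S * #S = ∑ a ∈ A, if {a} ⊆ S then w S else 0 := by
        intro S hS
        rw [← Finset.sum_filter, Finset.sum_const, nsmul_eq_mul, mul_comm]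
        congr 3
        ext a
        simpa using fun h => Finset.mem_powerset.1 hS h
      rw [Finset.sum_congr rfl h, Finset.sum_comm,
        Finset.sum_congr rfl fun a ha => hIcc {a} (Finset.singleton_subset_iff.2 ha)]
      simp [mul_comm]
    have hedge : ∑ S ∈ A.powerset, w S * #{e ∈ H | e ⊆ S} = ∑ e ∈ H, p ^ #e := by
      have h : ∀ S ∈ A.powerset,
          w S * #{e ∈ H | e ⊆ S} = ∑ e ∈ H, if e ⊆ S then w S else 0 := by
        intro S _
        rw [← Finset.sum_filter, Finset.sum_const, nsmul_eq_mul, mul_comm]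
      rw [Finset.sum_congr rfl h, Finset.sum_comm]
      exact Finset.sum_congr rfl fun e he => hIcc e (hH e he).1
    have hex : ∃ S ∈ A.powerset, 0 < w S := by
      by_contra! h
      linarith [Finset.sum_nonpos h]
    have key : ∑ S ∈ A.powerset, w S * ((#S : ℝ) - #{e ∈ H | e ⊆ S}) <
        ∑ S ∈ A.powerset, w S * (p * #A - ∑ e ∈ H, p ^ #e) := by
      obtain ⟨S, hS, hpos⟩ := hex
      exact Finset.sum_lt_sum (fun S hS => mul_le_mul_of_nonneg_left (hlt S hS).le (hw0 S))
        ⟨S, hS, mul_lt_mul_of_pos_left (hlt S hS) hpos⟩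
    simp only [mul_sub, Finset.sum_sub_distrib, ← Finset.sum_mul, hcard, hedge, hw1,
      one_mul] at key
    exact lt_irrefl _ key
  choose v hv using fun e : {e // e ∈ H ∧ e ⊆ S} => (hH e e.2.1).2
  set D : Finset α :=
    (H.filter fun e => e ⊆ S).attach.image fun e => v ⟨e.1, Finset.mem_filter.1 e.2⟩
  refine ⟨S \ D, Finset.sdiff_subset.trans (Finset.mem_powerset.1 hS), ?_, hle.trans ?_⟩
  · intro e he hsub
    have heS := hsub.trans Finset.sdiff_subset
    refine (Finset.mem_sdiff.1 (hsub (hv ⟨e, he, heS⟩))).2 (Finset.mem_image.2 ?_)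
    exact ⟨⟨e, Finset.mem_filter.2 ⟨he, heS⟩⟩, Finset.mem_attach _ _, rfl⟩
  · have h1 := Finset.le_card_sdiff D S
    have h2 : #D ≤ #{e ∈ H | e ⊆ S} := Finset.card_image_le.trans Finset.card_attach.le
    rw [sub_le_iff_le_add]
    exact_mod_cast (by omega : #S ≤ #(S \ D) + #{e ∈ H | e ⊆ S})

theorem card_le_sMul {A S : Finset ℝ} (hSA : S ⊆ A) (hS : IsMulSidon S) : #S ≤ sMul A := by
  classical
  exact Finset.le_sup (f := Finset.card)
    (Finset.mem_filter.2 ⟨Finset.mem_powerset.2 hSA, hS⟩)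

theorem card_le_EMul (A : Finset ℝ) : #A ≤ EMul A := by
  classical
  refine Finset.card_le_card_of_injOn (fun a => (a, a, a, a)) ?_ ?_
  · intro a ha
    simpa using ha
  · intro a _ b _ h
    exact congrArg Prod.fst h

/-- The three-term geometric progressions `c, a, d` in `A`, as triples `(a, c, d)`. -/
noncomputable def geomTriples (A : Finset ℝ) : Finset (ℝ × ℝ × ℝ) :=
  {x ∈ A ×ˢ A ×ˢ A | x.1 * x.1 = x.2.1 * x.2.2}

theorem card_geomTriples_sq_le {A : Finset ℝ} (hA : ∀ a ∈ A, 0 < a) :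
    #(geomTriples A) ^ 2 ≤ #A * EMul A := by
  classical
  set F : ℝ → Finset (ℝ × ℝ) := fun a => {y ∈ A ×ˢ A | a * a = y.1 * y.2} with hF
  have hcard : #(geomTriples A) = ∑ a ∈ A, #(F a) := by
    rw [← Finset.card_sigma]
    refine Finset.card_bij' (fun x _ => ⟨x.1, x.2⟩) (fun x _ => (x.1, x.2)) ?_ ?_ ?_ ?_ <;>
      simp [geomTriples, hF, and_assoc]
  rw [hcard]
  refine sq_sum_le_card_mul_sum_sq.trans (Nat.mul_le_mul_left _ ?_)
  have hsq : ∑ a ∈ A, #(F a) ^ 2 = #(A.sigma fun a => F a ×ˢ F a) := by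
    simp [Finset.card_sigma, sq]
  rw [hsq]
  refine Finset.card_le_card_of_injOn (fun x => (x.2.1.1, x.2.1.2, x.2.2.1, x.2.2.2)) ?_ ?_
  · rintro ⟨a, ⟨b, c⟩, d, e⟩ h
    simp only [hF, Finset.coe_sigma, Finset.mem_coe, Finset.mem_product,
      Finset.mem_filter, Set.mem_sigma_iff] at h
    simp only [Finset.mem_coe, Finset.mem_product, Finset.mem_filter]
    obtain ⟨-, ⟨⟨hb, hc⟩, h1⟩, ⟨hd, he⟩, h2⟩ := h
    exact ⟨⟨hb, hc, hd, he⟩, h1.symm.trans h2⟩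
  · rintro ⟨a, ⟨b, c⟩, d, e⟩ h ⟨a', ⟨b', c'⟩, d', e'⟩ h' heq
    simp only [hF, Finset.coe_sigma, Finset.mem_coe, Finset.mem_product,
      Finset.mem_filter, Set.mem_sigma_iff] at h h'
    simp only [Prod.mk.injEq] at heq
    obtain ⟨rfl, rfl, rfl, rfl⟩ := heq
    obtain rfl : a = a' := (mul_self_inj_of_nonneg (hA a h.1).le (hA a' h'.1).le).1
      (h.2.1.2.trans h'.2.1.2.symm)
    rfl

/-- Sparse random subsets of `A` contain large multiplicative Sidon sets. -/
theorem le_sMul_of_prob {A : Finset ℝ} (hA : ∀ a ∈ A, 0 < a) {p : ℝ} (hp0 : 0 ≤ p)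
    (hp1 : p ≤ 1) :
    p * #A - (#(geomTriples A) * p ^ 3 + EMul A * p ^ 4) ≤ sMul A := by
  classical
  set Q := (A ×ˢ A ×ˢ A ×ˢ A).filter fun x => x.1 * x.2.1 = x.2.2.1 * x.2.2.2 with hQ
  have hQE : #Q = EMul A := by
    unfold EMul
    congr!
  set H₃ : Finset (Finset ℝ) :=
    {e ∈ (geomTriples A).image fun x => {x.1, x.2.1, x.2.2} | #e = 3} with hH₃
  set H₄ : Finset (Finset ℝ) :=
    {e ∈ Q.image fun x => {x.1, x.2.1, x.2.2.1, x.2.2.2} | #e = 4} with hH₄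
  have hc₃ : ∀ e ∈ H₃, #e = 3 := fun e he => (Finset.mem_filter.1 he).2
  have hc₄ : ∀ e ∈ H₄, #e = 4 := fun e he => (Finset.mem_filter.1 he).2
  have hH : ∀ e ∈ H₃ ∪ H₄, e ⊆ A ∧ e.Nonempty := by
    intro e he
    rw [Finset.mem_union] at he
    rcases he with he | he
    · refine ⟨?_, Finset.card_pos.1 (by rw [hc₃ e he]; norm_num)⟩
      obtain ⟨x, hx, rfl⟩ := Finset.mem_image.1 (Finset.mem_filter.1 he).1
      simp only [geomTriples, Finset.mem_filter, Finset.mem_product] at hx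
      simp [Finset.insert_subset_iff, hx]
    · refine ⟨?_, Finset.card_pos.1 (by rw [hc₄ e he]; norm_num)⟩
      obtain ⟨x, hx, rfl⟩ := Finset.mem_image.1 (Finset.mem_filter.1 he).1
      simp only [hQ, Finset.mem_filter, Finset.mem_product] at hx
      simp [Finset.insert_subset_iff, hx]
  obtain ⟨S, hSA, hind, hS⟩ := exists_independent_subset A (H₃ ∪ H₄) hH hp0 hp1
  have hsum : ∑ e ∈ H₃ ∪ H₄, p ^ #e ≤ #(geomTriples A) * p ^ 3 + EMul A * p ^ 4 := by
    have hdis : Disjoint H₃ H₄ := Finset.disjoint_left.2 fun e h3 h4 => by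
      have := hc₃ e h3
      have := hc₄ e h4
      omega
    have hn₃ : #H₃ ≤ #(geomTriples A) := (Finset.card_filter_le _ _).trans Finset.card_image_le
    have hn₄ : #H₄ ≤ EMul A :=
      ((Finset.card_filter_le _ _).trans Finset.card_image_le).trans hQE.le
    rw [Finset.sum_union hdis, Finset.sum_congr rfl fun e he => by rw [hc₃ e he],
      Finset.sum_congr (s₁ := H₄) rfl fun e he => by rw [hc₄ e he], Finset.sum_const,
      Finset.sum_const, nsmul_eq_mul, nsmul_eq_mul]
    gcongr
  have hno₃ : ∀ a ∈ S, ∀ c ∈ S, ∀ d ∈ S, a * a = c * d → a = c ∨ a = d ∨ c = d := by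
    intro a ha c hc d hd h
    by_contra! hne
    refine hind {a, c, d} (Finset.mem_union_left _ (Finset.mem_filter.2
      ⟨Finset.mem_image.2 ⟨(a, c, d), ?_, rfl⟩, ?_⟩)) ?_
    · simp [geomTriples, hSA ha, hSA hc, hSA hd, h]
    · simp [Finset.card_insert_of_notMem, hne]
    · simp [Finset.insert_subset_iff, ha, hc, hd]
  have hSidon : IsMulSidon S := by
    intro a ha b hb c hc d hd h
    have pa := hA a (hSA ha)
    have pb := hA b (hSA hb)
    have pc := hA c (hSA hc)
    have pd := hA d (hSA hd)
    by_cases hac : a = c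
    · subst hac
      rw [mul_left_cancel₀ pa.ne' h]
    by_cases had : a = d
    · subst had
      rw [mul_comm c a] at h
      rw [mul_left_cancel₀ pa.ne' h, Finset.pair_comm]
    by_cases hbc : b = c
    · subst hbc
      rw [mul_comm b d] at h
      exact absurd (mul_right_cancel₀ pb.ne' h) had
    by_cases hbd : b = d
    · subst hbd
      exact absurd (mul_right_cancel₀ pb.ne' h) hac
    by_cases hab : a = b
    · subst hab
      rcases hno₃ a ha c hc d hd h with h' | h' | h'
      · exact absurd h' hac
      · exact absurd h' had
      · subst h'
        exact absurd ((mul_self_inj_of_nonneg pa.le pc.le).1 h) hac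
    by_cases hcd : c = d
    · subst hcd
      rcases hno₃ c hc a ha b hb h.symm with h' | h' | h'
      · exact absurd h'.symm hac
      · exact absurd h'.symm hbc
      · exact absurd h' hab
    refine absurd ?_ (hind {a, b, c, d} (Finset.mem_union_right _ (Finset.mem_filter.2
      ⟨Finset.mem_image.2 ⟨(a, b, c, d), ?_, rfl⟩, ?_⟩)))
    · simp [Finset.insert_subset_iff, ha, hb, hc, hd]
    · simp [hQ, hSA ha, hSA hb, hSA hc, hSA hd, h]
    · simp [Finset.card_insert_of_notMem, hac, had, hbc, hbd, hab, hcd]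
  have hle : (#S : ℝ) ≤ sMul A := by exact_mod_cast card_le_sMul hSA hSidon
  linarith

theorem stmt9 :
    ∃ c : ℝ, 0 < c ∧ ∀ A : Finset ℝ, A.Nonempty → (∀ a ∈ A, 0 < a) →
      c * (A.card : ℝ) ^ 4 ≤ (sMul A : ℝ) ^ 3 * (EMul A : ℝ) := by
  refine ⟨1 / 64, by norm_num, fun A hne hA => ?_⟩
  have hn : (0 : ℝ) < #A := by exact_mod_cast hne.card_pos
  have hnE : (#A : ℝ) ≤ EMul A := by exact_mod_cast card_le_EMul A
  have hT : (#(geomTriples A) : ℝ) ^ 2 ≤ #A * EMul A := by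
    exact_mod_cast card_geomTriples_sq_le hA
  have hprob := fun p : ℝ => le_sMul_of_prob (p := p) hA
  generalize (#A : ℝ) = n at *
  generalize (EMul A : ℝ) = E at *
  generalize (#(geomTriples A) : ℝ) = T at *
  generalize (sMul A : ℝ) = s at *
  have hE : 0 < E := hn.trans_le hnE
  obtain ⟨q, hq0, hq1, hq⟩ : ∃ q : ℝ, 0 < q ∧ q ≤ 1 ∧ q ^ 3 * E = n := by
    refine ⟨(n / E) ^ (1 / 3 : ℝ), by positivity,
      Real.rpow_le_one (by positivity) ((div_le_one hE).2 hnE) (by norm_num), ?_⟩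
    rw [← Real.rpow_natCast, ← Real.rpow_mul (by positivity)]
    norm_num
    field_simp
  subst hq
  have hTE : T ≤ q * E := by
    refine le_of_sq_le_sq ?_ (by positivity)
    calc T ^ 2 ≤ q ^ 3 * E * E := hT
      _ = q * (q * E) ^ 2 := by ring
      _ ≤ 1 * (q * E) ^ 2 := by gcongr
      _ = (q * E) ^ 2 := one_mul _
  have hs : q ^ 4 * E / 4 ≤ s := by
    have h := hprob (q / 2) (by positivity) (by linarith)
    have hTq : T * q ^ 3 ≤ q * E * q ^ 3 := by gcongr
    have hpos : 0 ≤ q ^ 4 * E := by positivity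
    nlinarith
  calc 1 / 64 * (q ^ 3 * E) ^ 4 = (q ^ 4 * E / 4) ^ 3 * E := by ring
    _ ≤ s ^ 3 * E := by gcongr
end

section
/- There exists a constant c > 0 such that the following holds: if A ⊂ ℝ is a finite nonempty set and A' ⊆ A is a subset with |A'| ≥ |A|/2 and E₊(A') ≤ |A|^{7/3}, then s₊(A) ≥ c·|A|^{5/9}. -/
open Finset

section Deletion

variable {α ι : Type*} [DecidableEq α]

/-- The weights `p ^ #S * (1 - p) ^ #(V \ S)` of the random subset `S ⊆ V` containing a fixed
`T ⊆ V` add up to `p ^ #T`. -/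
theorem sum_powerset_superset_weight (V T : Finset α) (hT : T ⊆ V) (p : ℝ) :
    ∑ S ∈ V.powerset, (if T ⊆ S then p ^ #S * (1 - p) ^ #(V \ S) else 0) = p ^ #T := by
  have h := Finset.prod_add (fun _ : α => p) (fun i => if i ∈ T then 0 else 1 - p) V
  have hprod : ∏ i ∈ V, (p + if i ∈ T then 0 else 1 - p) = p ^ #T := by
    rw [← Finset.prod_sdiff hT, Finset.prod_eq_one, one_mul,
      Finset.prod_congr rfl (g := fun _ => p), Finset.prod_const]
    · intro i hi
      simp [hi]
    · intro i hi
      simp [(Finset.mem_sdiff.1 hi).2]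
  rw [← hprod, h]
  refine Finset.sum_congr rfl fun S _ => ?_
  rw [Finset.prod_const]
  split_ifs with hTS
  · congr 1
    rw [Finset.prod_congr rfl (g := fun _ => 1 - p), Finset.prod_const]
    intro i hi
    rw [if_neg fun hiT => (Finset.mem_sdiff.1 hi).2 (hTS hiT)]
  · obtain ⟨i, hiT, hiS⟩ := Finset.not_subset.1 hTS
    rw [Finset.prod_eq_zero (i := i) (Finset.mem_sdiff.2 ⟨hT hiT, hiS⟩) (by simp [hiT]), mul_zero]

/-- The deletion method: a hypergraph on `V` with nonempty edges `e q`, `q ∈ Q`, has an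
independent set of size at least `p * #V - ∑ q ∈ Q, p ^ #(e q)`. -/
theorem exists_independent_card_ge (V : Finset α) (Q : Finset ι) (e : ι → Finset α)
    (hV : ∀ q ∈ Q, e q ⊆ V) (hne : ∀ q ∈ Q, (e q).Nonempty) {p : ℝ} (hp0 : 0 ≤ p) (hp1 : p ≤ 1) :
    ∃ S ⊆ V, (∀ q ∈ Q, ¬ e q ⊆ S) ∧ p * #V - ∑ q ∈ Q, p ^ #(e q) ≤ #S := by
  classical
  set w : Finset α → ℝ := fun S => p ^ #S * (1 - p) ^ #(V \ S)
  have hw0 : ∀ S, 0 ≤ w S := fun S => mul_nonneg (pow_nonneg hp0 _) (pow_nonneg (by linarith) _)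
  set M : ℝ := p * #V - ∑ q ∈ Q, p ^ #(e q) with hM
  have htotal : ∑ S ∈ V.powerset, w S = 1 := by
    simpa using sum_powerset_superset_weight V ∅ (by simp) p
  have hcard : ∑ S ∈ V.powerset, w S * #S = p * #V := by
    calc ∑ S ∈ V.powerset, w S * #S
        = ∑ S ∈ V.powerset, ∑ v ∈ V, if {v} ⊆ S then w S else 0 := by
          refine Finset.sum_congr rfl fun S hS => ?_
          simp only [Finset.singleton_subset_iff]
          rw [← Finset.sum_filter, Finset.sum_const, nsmul_eq_mul, mul_comm,
            Finset.filter_mem_eq_inter, Finset.inter_eq_right.2 (Finset.mem_powerset.1 hS)]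
      _ = ∑ v ∈ V, ∑ S ∈ V.powerset, if {v} ⊆ S then w S else 0 := Finset.sum_comm
      _ = ∑ v ∈ V, p := by
          refine Finset.sum_congr rfl fun v hv => ?_
          simpa using sum_powerset_superset_weight V {v} (by simpa using hv) p
      _ = p * #V := by simp [mul_comm]
  have hedge : ∑ S ∈ V.powerset, w S * #{q ∈ Q | e q ⊆ S} = ∑ q ∈ Q, p ^ #(e q) := by
    calc ∑ S ∈ V.powerset, w S * #{q ∈ Q | e q ⊆ S}
        = ∑ S ∈ V.powerset, ∑ q ∈ Q, if e q ⊆ S then w S else 0 := by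
          refine Finset.sum_congr rfl fun S _ => ?_
          rw [← Finset.sum_filter, Finset.sum_const, nsmul_eq_mul, mul_comm]
      _ = ∑ q ∈ Q, ∑ S ∈ V.powerset, if e q ⊆ S then w S else 0 := Finset.sum_comm
      _ = ∑ q ∈ Q, p ^ #(e q) :=
          Finset.sum_congr rfl fun q hq => sum_powerset_superset_weight V (e q) (hV q hq) p
  obtain ⟨S, hSV, hS⟩ : ∃ S ∈ V.powerset, M ≤ (#S : ℝ) - #{q ∈ Q | e q ⊆ S} := by
    by_contra! hlt
    have hle : ∑ S ∈ V.powerset, w S * (M - ((#S : ℝ) - #{q ∈ Q | e q ⊆ S})) = 0 := by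
      simp only [mul_sub, Finset.sum_sub_distrib]
      rw [← Finset.sum_mul, htotal, hcard, hedge, hM]
      ring
    have hzero := (Finset.sum_eq_zero_iff_of_nonneg fun S hS =>
      mul_nonneg (hw0 S) (sub_nonneg.2 (hlt S hS).le)).1 hle
    have : ∑ S ∈ V.powerset, w S = 0 := Finset.sum_eq_zero fun S hS =>
      (mul_eq_zero.1 (hzero S hS)).resolve_right (sub_pos.2 (hlt S hS)).ne'
    linarith
  have hpick : ∀ q : {q // q ∈ Q}, ∃ v, v ∈ e q := fun q => hne q q.2
  choose f hf using hpick
  set D : Finset α := (Q.attach.filter fun q : {q // q ∈ Q} => e q ⊆ S).image f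
  have hDcard : #D ≤ #{q ∈ Q | e q ⊆ S} := by
    refine Finset.card_image_le.trans (Finset.card_le_card_of_injOn Subtype.val ?_
      Subtype.val_injective.injOn)
    intro q hq
    simpa using hq
  refine ⟨S \ D, Finset.sdiff_subset.trans (Finset.mem_powerset.1 hSV), fun q hq hsub => ?_, ?_⟩
  · refine (Finset.mem_sdiff.1 (hsub (hf ⟨q, hq⟩))).2 (Finset.mem_image_of_mem f ?_)
    simpa using hsub.trans Finset.sdiff_subset
  · have h1 : (#S : ℝ) ≤ #(S \ D) + #D := by
      exact_mod_cast Nat.sub_le_iff_le_add.1 (Finset.le_card_sdiff D S)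
    have h2 : (#D : ℝ) ≤ #{q ∈ Q | e q ⊆ S} := by exact_mod_cast hDcard
    linarith

end Deletion

open scoped Classical in
/-- The number of solutions of `a + a = c + d` in `B` is at most `√(#B * EAdd B)`. -/
theorem sq_card_midpoint_le (B : Finset ℝ) :
    #{x ∈ B ×ˢ B ×ˢ B | x.1 + x.1 = x.2.1 + x.2.2} ^ 2 ≤ #B * EAdd B := by
  set F : ℝ → Finset (ℝ × ℝ) := fun a => {y ∈ B ×ˢ B | a + a = y.1 + y.2} with hF
  have hT : #{x ∈ B ×ˢ B ×ˢ B | x.1 + x.1 = x.2.1 + x.2.2} = ∑ a ∈ B, #(F a) := by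
    rw [Finset.card_filter, Finset.sum_product]
    simp only [hF, Finset.card_filter]
  have hE : ∑ a ∈ B, #(F a) ^ 2 ≤ EAdd B := by
    have : ∑ a ∈ B, #(F a) ^ 2 = #(B.sigma fun a => F a ×ˢ F a) := by
      simp [Finset.card_sigma, sq]
    rw [this]
    refine Finset.card_le_card_of_injOn (fun z => (z.2.1.1, z.2.1.2, z.2.2.1, z.2.2.2)) ?_ ?_
    · rintro ⟨a, ⟨b, c⟩, d, e⟩ h
      simp [hF] at h ⊢
      grind
    · rintro ⟨a, ⟨b, c⟩, d, e⟩ h ⟨a', ⟨b', c'⟩, d', e'⟩ h' heq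
      simp [hF] at h h' heq
      obtain ⟨rfl, rfl, rfl, rfl⟩ := heq
      obtain rfl : a = a' := by linarith [h.2.1.2, h'.2.1.2]
      rfl
  rw [hT]
  exact sq_sum_le_card_mul_sum_sq.trans (Nat.mul_le_mul_left _ hE)

open scoped Classical in
/-- A random subset of density `p` in a set of small additive energy contains a large
Sidon set. -/
theorem exists_isAddSidon_card_ge (B : Finset ℝ) {p : ℝ} (hp0 : 0 ≤ p) (hp1 : p ≤ 1) :
    ∃ S ⊆ B, IsAddSidon S ∧
      p * #B - (p ^ 4 * EAdd B + p ^ 3 * √(#B * EAdd B)) ≤ #S := by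
  set P : Finset (ℝ × ℝ × ℝ × ℝ) :=
    {x ∈ B ×ˢ B ×ˢ B ×ˢ B | x.1 + x.2.1 = x.2.2.1 + x.2.2.2} with hP
  set e : ℝ × ℝ × ℝ × ℝ → Finset ℝ := fun x => {x.1, x.2.1, x.2.2.1, x.2.2.2} with he
  set Q₄ := {x ∈ P | #(e x) = 4} with hQ₄
  set Q₃ := {x ∈ P | x.1 = x.2.1 ∧ #(e x) = 3} with hQ₃
  have hmem : ∀ q ∈ Q₄ ∪ Q₃, q ∈ P := by
    intro q hq
    rcases Finset.mem_union.1 hq with h | h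
    · exact (Finset.mem_filter.1 h).1
    · exact (Finset.mem_filter.1 h).1
  obtain ⟨S, hSB, hS, hcard⟩ := exists_independent_card_ge B (Q₄ ∪ Q₃) e
    (fun q hq => by
      have := hmem q hq
      simp only [hP, Finset.mem_filter, Finset.mem_product] at this
      intro v hv
      simp only [he, Finset.mem_insert, Finset.mem_singleton] at hv
      grind)
    (fun q _ => Finset.insert_nonempty _ _) hp0 hp1
  have hfour : ∑ q ∈ Q₄, p ^ #(e q) ≤ p ^ 4 * EAdd B := by
    rw [Finset.sum_congr rfl (g := fun _ => p ^ 4) fun q hq => by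
      rw [(Finset.mem_filter.1 hq).2], Finset.sum_const, nsmul_eq_mul, mul_comm]
    refine mul_le_mul_of_nonneg_left ?_ (pow_nonneg hp0 _)
    exact_mod_cast Finset.card_filter_le _ _
  have hthree : ∑ q ∈ Q₃, p ^ #(e q) ≤ p ^ 3 * √(#B * EAdd B) := by
    rw [Finset.sum_congr rfl (g := fun _ => p ^ 3) fun q hq => by
      rw [(Finset.mem_filter.1 hq).2.2], Finset.sum_const, nsmul_eq_mul, mul_comm]
    refine mul_le_mul_of_nonneg_left ?_ (pow_nonneg hp0 _)
    refine Real.le_sqrt_of_sq_le ?_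
    have hinj : #Q₃ ≤ #{x ∈ B ×ˢ B ×ˢ B | x.1 + x.1 = x.2.1 + x.2.2} := by
      refine Finset.card_le_card_of_injOn (fun x => (x.1, x.2.2)) ?_ ?_
      · rintro ⟨a, b, c, d⟩ h
        simp [hQ₃, hP] at h ⊢
        grind
      · rintro ⟨a, b, c, d⟩ h ⟨a', b', c', d'⟩ h' heq
        simp [hQ₃] at h h' heq ⊢
        grind
    exact_mod_cast (Nat.pow_le_pow_left hinj 2).trans (sq_card_midpoint_le B)
  have hunion : ∑ q ∈ Q₄ ∪ Q₃, p ^ #(e q) ≤ ∑ q ∈ Q₄, p ^ #(e q) + ∑ q ∈ Q₃, p ^ #(e q) := by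
    rw [← Finset.sum_union_inter]
    exact le_add_of_nonneg_right (Finset.sum_nonneg fun q _ => pow_nonneg hp0 _)
  refine ⟨S, hSB, ?_, by linarith⟩
  have hdiag : ∀ a ∈ S, ∀ c ∈ S, ∀ d ∈ S, a + a = c + d → a = c := by
    intro a ha c hc d hd h
    by_contra hac
    have hcd : c ≠ d := by rintro rfl; exact hac (by linarith)
    have had : a ≠ d := by rintro rfl; exact hac (by linarith)
    refine hS (a, a, c, d) (Finset.mem_union_right _ ?_) ?_
    · simp [hQ₃, hP, he, hSB ha, hSB hc, hSB hd, h, hac, hcd, had]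
    · simp [he, Finset.insert_subset_iff, ha, hc, hd]
  intro a ha b hb c hc d hd h
  by_cases hac : a = c
  · obtain rfl : b = d := by linarith
    rw [hac]
  by_cases had : a = d
  · obtain rfl : b = c := by linarith
    rw [had, Finset.pair_comm]
  have hab : a ≠ b := by
    rintro rfl
    exact hac (hdiag a ha c hc d hd h)
  have hcd : c ≠ d := by
    rintro rfl
    exact hac (hdiag c hc a ha b hb h.symm).symm
  have hbc : b ≠ c := by rintro rfl; exact had (by linarith)
  have hbd : b ≠ d := by rintro rfl; exact hac (by linarith)
  refine absurd ?_ (hS (a, b, c, d) (Finset.mem_union_left _ ?_))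
  · simp [he, Finset.insert_subset_iff, ha, hb, hc, hd]
  · simp [hQ₄, hP, he, hSB ha, hSB hb, hSB hc, hSB hd, h, hab, hac, had, hbc, hbd, hcd]

theorem stmt17 :
    ∃ c : ℝ, 0 < c ∧ ∀ A : Finset ℝ, A.Nonempty → ∀ A' ⊆ A,
      (A.card : ℝ) / 2 ≤ (A'.card : ℝ) →
      (EAdd A' : ℝ) ≤ (A.card : ℝ) ^ ((7 : ℝ) / 3) →
      c * (A.card : ℝ) ^ ((5 : ℝ) / 9) ≤ (sAdd A : ℝ) := by
  classical
  refine ⟨1 / 16, by norm_num, fun A hA A' hA' hhalf hE => ?_⟩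
  have hN : (1 : ℝ) ≤ #A := by exact_mod_cast hA.card_pos
  obtain ⟨x, hx1, hx9⟩ : ∃ x : ℝ, 1 ≤ x ∧ (#A : ℝ) = x ^ 9 := by
    refine ⟨(#A : ℝ) ^ ((1 : ℝ) / 9), Real.one_le_rpow hN (by norm_num), ?_⟩
    rw [← Real.rpow_natCast, ← Real.rpow_mul (by positivity)]
    norm_num
  have hx0 : 0 < x := by linarith
  have h21 : (#A : ℝ) ^ ((7 : ℝ) / 3) = x ^ 21 := by
    rw [hx9, ← Real.rpow_natCast, ← Real.rpow_natCast, ← Real.rpow_mul hx0.le]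
    norm_num
  have h5 : (#A : ℝ) ^ ((5 : ℝ) / 9) = x ^ 5 := by
    rw [hx9, ← Real.rpow_natCast, ← Real.rpow_natCast, ← Real.rpow_mul hx0.le]
    norm_num
  rw [h21] at hE
  rw [h5]
  have hp1 : 1 / (4 * x ^ 4) ≤ 1 := by
    rw [div_le_one (by positivity)]
    linarith [one_le_pow₀ hx1 (n := 4)]
  obtain ⟨S, hSA', hS, hcard⟩ := exists_isAddSidon_card_ge A' (p := 1 / (4 * x ^ 4))
    (by positivity) hp1
  have hle : (#S : ℝ) ≤ sAdd A := by
    have : #S ≤ sAdd A := Finset.le_sup (f := Finset.card)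
      (Finset.mem_filter.2 ⟨Finset.mem_powerset.2 (hSA'.trans hA'), hS⟩)
    exact_mod_cast this
  have hsqrt : √(#A' * EAdd A') ≤ x ^ 15 := by
    refine Real.sqrt_le_iff.2 ⟨by positivity, ?_⟩
    have hA'x : (#A' : ℝ) ≤ x ^ 9 := by
      rw [← hx9]
      exact_mod_cast Finset.card_le_card hA'
    calc (#A' : ℝ) * EAdd A' ≤ x ^ 9 * x ^ 21 := by gcongr
      _ = (x ^ 15) ^ 2 := by ring
  have hmain : x ^ 5 / 8 ≤ 1 / (4 * x ^ 4) * #A' := by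
    calc x ^ 5 / 8 = 1 / (4 * x ^ 4) * (x ^ 9 / 2) := by field_simp; norm_num
      _ ≤ 1 / (4 * x ^ 4) * #A' := by
        rw [hx9] at hhalf
        gcongr
  have hquad : (1 / (4 * x ^ 4)) ^ 4 * EAdd A' ≤ x ^ 5 / 256 := by
    calc (1 / (4 * x ^ 4)) ^ 4 * EAdd A' ≤ (1 / (4 * x ^ 4)) ^ 4 * x ^ 21 := by gcongr
      _ = x ^ 5 / 256 := by field_simp; norm_num
  have htriple : (1 / (4 * x ^ 4)) ^ 3 * √(#A' * EAdd A') ≤ x ^ 5 / 64 := by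
    calc (1 / (4 * x ^ 4)) ^ 3 * √(#A' * EAdd A') ≤ (1 / (4 * x ^ 4)) ^ 3 * x ^ 15 := by gcongr
      _ = x ^ 3 / 64 := by field_simp; norm_num
      _ ≤ x ^ 5 / 64 := by gcongr; norm_num
  have hx5 : 0 < x ^ 5 := by positivity
  linarith
end
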